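/- Let d ≥ 2, let i be a nonnegative integer, and let Ω_i be measurable on S^{d−1} with ‖Ω_i‖_{L^∞(S^{d−1})} ≤ 2^i. Let j ∈ ℤ, let s ≥ 100 be an integer, let Q be a cube of side length 2^{j−s}, let h_Q ∈ L¹(ℝ^d) be supported in Q, and let b ∈ BMO(ℝ^d). Then ‖(b − ⟨b⟩_Q) T_j^i h_Q‖_{L¹(ℝ^d)} ≤ C_d ‖b‖_{BMO} (2^{−i} + (i+s)‖Ω_i‖_{L¹(S^{d−1})}) ‖h_Q‖_{L¹(ℝ^d)}, with C_d depending only on d. -/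

import Mathlib

open MeasureTheory Metric Set Filter
open scoped ENNReal NNReal Real Topology Pointwise FourierTransform RealInnerProductSpace

noncomputable section

/-- Euclidean space `ℝ^d`. -/
abbrev Rd (d : ℕ) := EuclideanSpace ℝ (Fin d)

/-- Surface measure on the unit sphere `S^{d-1}`, realized as the `(d-1)`-dimensional
Hausdorff measure restricted to the sphere. -/
def sphereMeasure (d : ℕ) : Measure (Rd d) := (μH[(d : ℝ) - 1]).restrict (sphere (0 : Rd d) 1)

/-- `Φ(t) = t log(e + t)`. -/
def Phi (t : ℝ) : ℝ := t * Real.log (Real.exp 1 + t)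

/-- `Q` is an (axis-parallel, closed) cube with side length `l`. -/
def IsCubeSide {d : ℕ} (Q : Set (Rd d)) (l : ℝ) : Prop :=
  ∃ c : Rd d, Q = {x | ∀ i, x i ∈ Icc (c i) (c i + l)}

/-- `Q` is a (nondegenerate) cube. -/
def IsCube {d : ℕ} (Q : Set (Rd d)) : Prop := ∃ l : ℝ, 0 < l ∧ IsCubeSide Q l

/-- `Q` is a standard dyadic cube `2^k([0,1]^d + m)`. -/
def IsDyadicCube {d : ℕ} (Q : Set (Rd d)) : Prop :=
  ∃ (k : ℤ) (m : Fin d → ℤ),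
    Q = {x | ∀ i, x i ∈ Icc ((2:ℝ)^k * m i) ((2:ℝ)^k * (m i + 1))}

/-- mean value `⟨b⟩_Q` of `b` on `Q`. -/
def cavg {d : ℕ} (b : Rd d → ℝ) (Q : Set (Rd d)) : ℝ := ⨍ x in Q, b x

/-- `b` is in `BMO(ℝ^d)` with `‖b‖_{BMO} ≤ M`. -/
def BMOBound {d : ℕ} (b : Rd d → ℝ) (M : ℝ) : Prop :=
  MeasureTheory.LocallyIntegrable b volume ∧
    ∀ Q : Set (Rd d), IsCube Q → (⨍ x in Q, |b x - cavg b Q|) ≤ M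

/-- `Ω` is homogeneous of degree zero. -/
def Homog0 {d : ℕ} (Ω : Rd d → ℝ) : Prop := ∀ r : ℝ, 0 < r → ∀ x : Rd d, Ω (r • x) = Ω x

/-- The Luxemburg norm `‖f‖_{L^p(log L)^α, Q}`
(`∞`, i.e. `⊤`, if no admissible constant exists). -/
def LuxNorm {d : ℕ} (p α : ℝ) (Q : Set (Rd d)) (f : Rd d → ℝ) : ℝ≥0∞ :=
  sInf {c : ℝ≥0∞ | ∃ t : ℝ, 0 < t ∧ c = ENNReal.ofReal t ∧
    ∫⁻ x in Q,
      ENNReal.ofReal ((|f x| / t) ^ p * (Real.log (Real.exp 1 + |f x| / t)) ^ α) ≤ volume Q}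

/-- convolution `K * g`. -/
def convK {d : ℕ} (K g : Rd d → ℝ) (x : Rd d) : ℝ := ∫ y, K (x - y) * g y

/-- Truncated kernel `K_j(x) = Ω(x/|x|)|x|^{-d} φ_j(x)`, where `φ_j(x) = φ(2^{-j}x)`. -/
def Kj {d : ℕ} (Ωi φ : Rd d → ℝ) (j : ℤ) (x : Rd d) : ℝ :=
  Ωi (‖x‖⁻¹ • x) / ‖x‖ ^ d * φ ((2:ℝ) ^ (-j) • x)

/-- Hypotheses on the radial cut-off function `φ`: smooth, nonnegative, radial,
supported in `{1/2 ≤ |x| ≤ 2}`, with `Σ_j φ(2^{-j}x) = 1` for `x ≠ 0`. -/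
def PhiCutoff {d : ℕ} (φ : Rd d → ℝ) : Prop :=
  ContDiff ℝ (⊤ : ℕ∞) φ ∧ (∀ x, 0 ≤ φ x) ∧ (∃ g : ℝ → ℝ, ∀ x, φ x = g ‖x‖) ∧
    Function.support φ ⊆ {x : Rd d | 1/2 ≤ ‖x‖ ∧ ‖x‖ ≤ 2} ∧
    ∀ x : Rd d, x ≠ 0 → HasSum (fun j : ℤ => φ ((2:ℝ) ^ (-j) • x)) 1

/-- The half-open cube with lower corner `c` and side length `l`. -/
def halfOpenCube {d : ℕ} (c : Rd d) (l : ℝ) : Set (Rd d) :=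
  {x | ∀ i, x i ∈ Ico (c i) (c i + l)}

lemma halfOpenCube_eq_preimage {d : ℕ} (c : Rd d) (l : ℝ) :
    halfOpenCube c l =
      WithLp.ofLp ⁻¹' (Set.pi univ fun i => Ico (c i) (c i + l)) := by
  ext x; simp [halfOpenCube]

lemma measurableSet_halfOpenCube {d : ℕ} (c : Rd d) (l : ℝ) :
    MeasurableSet (halfOpenCube c l) := by
  rw [halfOpenCube_eq_preimage]
  exact (PiLp.volume_preserving_ofLp (Fin d)).measurable
    (MeasurableSet.univ_pi fun _ => measurableSet_Ico)

lemma volume_halfOpenCube {d : ℕ} (c : Rd d) {l : ℝ} (hl : 0 ≤ l) :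
    volume (halfOpenCube c l) = ENNReal.ofReal (l ^ d) := by
  rw [halfOpenCube_eq_preimage, (PiLp.volume_preserving_ofLp (Fin d)).measure_preimage
    (MeasurableSet.univ_pi fun _ => measurableSet_Ico).nullMeasurableSet, Real.volume_pi_Ico]
  simp [ENNReal.ofReal_pow hl]

lemma volume_real_halfOpenCube {d : ℕ} (c : Rd d) {l : ℝ} (hl : 0 ≤ l) :
    volume.real (halfOpenCube c l) = l ^ d := by
  rw [Measure.real, volume_halfOpenCube c hl, ENNReal.toReal_ofReal (by positivity)]

lemma closedCube_eq_preimage {d : ℕ} (c : Rd d) (l : ℝ) :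
    {x : Rd d | ∀ i, x i ∈ Icc (c i) (c i + l)} =
      WithLp.ofLp ⁻¹' (Set.Icc (WithLp.ofLp c) (fun i => c i + l)) := by
  ext x; simp [Pi.le_def, forall_and]

lemma closedCube_ae_eq {d : ℕ} (c : Rd d) (l : ℝ) :
    ({x : Rd d | ∀ i, x i ∈ Icc (c i) (c i + l)} : Set (Rd d)) =ᵐ[volume] halfOpenCube c l := by
  rw [closedCube_eq_preimage, halfOpenCube_eq_preimage]
  exact (PiLp.volume_preserving_ofLp (Fin d)).quasiMeasurePreserving.preimage_ae_eq
    Measure.univ_pi_Ico_ae_eq_Icc.symm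

lemma isCompact_closedCube {d : ℕ} (c : Rd d) (l : ℝ) :
    IsCompact {x : Rd d | ∀ i, x i ∈ Icc (c i) (c i + l)} := by
  rw [closedCube_eq_preimage]
  exact (PiLp.homeomorph 2 (fun _ : Fin d => ℝ)).isCompact_preimage.2 isCompact_Icc

lemma halfOpenCube_subset_closedCube {d : ℕ} (c : Rd d) (l : ℝ) :
    halfOpenCube c l ⊆ {x : Rd d | ∀ i, x i ∈ Icc (c i) (c i + l)} :=
  fun _ hx i => Ico_subset_Icc_self (hx i)

lemma integrableOn_halfOpenCube {d : ℕ} {b : Rd d → ℝ} (hb : LocallyIntegrable b volume)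
    (c : Rd d) (l : ℝ) : IntegrableOn b (halfOpenCube c l) :=
  (hb.integrableOn_isCompact (isCompact_closedCube c l)).mono_set
    (halfOpenCube_subset_closedCube c l)

/-- The lower corner of the dyadic child of a cube selected by `e`. -/
def childCorner {d : ℕ} (c : Rd d) (l : ℝ) (e : Fin d → Bool) : Rd d :=
  WithLp.toLp 2 fun i => c i + if e i then l / 2 else 0

lemma halfOpenCube_eq_iUnion_child {d : ℕ} (c : Rd d) {l : ℝ} (hl : 0 < l) :
    halfOpenCube c l = ⋃ e : Fin d → Bool, halfOpenCube (childCorner c l e) (l / 2) := by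
  ext x
  simp only [halfOpenCube, childCorner, mem_iUnion, mem_ofPred_eq, mem_Ico]
  constructor
  · intro hx
    refine ⟨fun i => decide (c i + l / 2 ≤ x i), fun i => ?_⟩
    have := hx i
    by_cases h : c i + l / 2 ≤ x i
    · simp [h]; linarith
    · simp [h]; push Not at h; constructor <;> linarith
  · rintro ⟨e, he⟩ i
    have := he i
    cases h : e i <;> simp [h] at this <;> constructor <;> linarith

lemma pairwise_disjoint_child {d : ℕ} (c : Rd d) (l : ℝ) :
    Pairwise (Function.onFun Disjoint
      fun e : Fin d → Bool => halfOpenCube (childCorner c l e) (l / 2)) := by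
  intro e e' hne
  refine Set.disjoint_left.2 fun x hx hx' => hne (funext fun i => ?_)
  have h1 := hx i
  have h2 := hx' i
  simp only [childCorner, mem_Ico] at h1 h2
  cases h : e i <;> cases h' : e' i <;> simp [h, h'] at h1 h2 ⊢ <;> linarith

lemma halfOpenCube_child_subset {d : ℕ} (c : Rd d) {l : ℝ} (hl : 0 < l) (e : Fin d → Bool) :
    halfOpenCube (childCorner c l e) (l / 2) ⊆ halfOpenCube c l := by
  rw [halfOpenCube_eq_iUnion_child c hl]
  exact subset_iUnion (fun e => halfOpenCube (childCorner c l e) (l / 2)) e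

lemma setIntegral_halfOpenCube_eq_sum_child {d : ℕ} {f : Rd d → ℝ} (c : Rd d) {l : ℝ}
    (hl : 0 < l) (hf : IntegrableOn f (halfOpenCube c l)) :
    ∫ x in halfOpenCube c l, f x =
      ∑ e : Fin d → Bool, ∫ x in halfOpenCube (childCorner c l e) (l / 2), f x := by
  rw [halfOpenCube_eq_iUnion_child c hl]
  exact integral_iUnion_fintype (fun e => measurableSet_halfOpenCube _ _)
    (pairwise_disjoint_child c l)
    fun e => hf.mono_set (halfOpenCube_child_subset c hl e)

/-- Replacing the centre of an oscillation integral by the average costs a factor of the average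
oscillation. -/
lemma abs_average_sub_mul_le {d : ℕ} {b : Rd d → ℝ} (hb : LocallyIntegrable b volume)
    (c : Rd d) {l : ℝ} (hl : 0 < l) (a : ℝ) :
    |(⨍ x in halfOpenCube c l, b x) - a| * l ^ d ≤ ∫ x in halfOpenCube c l, |b x - a| := by
  have hi := integrableOn_halfOpenCube hb c l
  have hfin : volume (halfOpenCube c l) ≠ ∞ := by
    rw [volume_halfOpenCube c hl.le]; exact ENNReal.ofReal_ne_top
  have hld : 0 < l ^ d := by positivity
  have h1 : ∫ x in halfOpenCube c l, (b x - a) =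
      ((⨍ x in halfOpenCube c l, b x) - a) * l ^ d := by
    rw [integral_sub hi (integrableOn_const hfin), setAverage_eq, setIntegral_const,
      volume_real_halfOpenCube c hl.le]
    simp only [smul_eq_mul]
    field_simp
  calc _ = |∫ x in halfOpenCube c l, (b x - a)| := by rw [h1, abs_mul, abs_of_pos hld]
    _ ≤ _ := abs_integral_le_integral_abs

lemma BMOBound.integral_halfOpenCube_le {d : ℕ} {b : Rd d → ℝ} {M : ℝ} (hb : BMOBound b M)
    (c : Rd d) {l : ℝ} (hl : 0 < l) :
    ∫ x in halfOpenCube c l, |b x - ⨍ y in halfOpenCube c l, b y| ≤ M * l ^ d := by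
  have h := hb.2 _ ⟨l, hl, c, rfl⟩
  have hld : 0 < l ^ d := by positivity
  rw [cavg, setAverage_congr (closedCube_ae_eq c l), setAverage_congr (closedCube_ae_eq c l),
    setAverage_eq, volume_real_halfOpenCube c hl.le, smul_eq_mul, inv_mul_le_iff₀ hld] at h
  linarith

/-- The good part of a cube, in the stopping-time argument behind the John–Nirenberg inequality,
is controlled by the error of approximating `b` by a uniformly continuous function. -/
lemma integral_max_sub_le_of_uniform {d : ℕ} {b g : Rd d → ℝ} (hb : LocallyIntegrable b volume)
    (hg : Continuous g) {T m ε δ a : ℝ} (hmT : m ≤ T)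
    (huc : ∀ x y, (∀ i, |x i - y i| ≤ δ) → |g x - g y| ≤ ε)
    (c : Rd d) {l : ℝ} (hl : 0 < l) (hlδ : l ≤ δ)
    (hm : ∫ x in halfOpenCube c l, |b x - a| ≤ m * l ^ d) :
    ∫ x in halfOpenCube c l, max (|b x - a| - T) 0 ≤
      2 * (∫ x in halfOpenCube c l, |b x - g x|) + 2 * ε * l ^ d := by
  have hbi := integrableOn_halfOpenCube hb c l
  have hgi := integrableOn_halfOpenCube hg.locallyIntegrable c l
  have hfin : volume (halfOpenCube c l) ≠ ∞ := by
    rw [volume_halfOpenCube c hl.le]; exact ENNReal.ofReal_ne_top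
  have hconst : ∀ r : ℝ, IntegrableOn (fun _ => r) (halfOpenCube c l) :=
    fun r => integrableOn_const hfin
  have hld : 0 < l ^ d := by positivity
  have hc : ∀ x ∈ halfOpenCube c l, |g x - g c| ≤ ε := fun x hx => huc x c fun i => by
    have := hx i
    rw [abs_le]; constructor <;> linarith [this.1, this.2]
  have hba : IntegrableOn (fun x => |b x - a|) (halfOpenCube c l) := (hbi.sub (hconst a)).abs
  have hbg : IntegrableOn (fun x => |b x - g x|) (halfOpenCube c l) := (hbi.sub hgi).abs
  have hint : ∀ r : ℝ, ∫ _ in halfOpenCube c l, r = r * l ^ d := fun r => by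
    rw [setIntegral_const, volume_real_halfOpenCube c hl.le, smul_eq_mul, mul_comm]
  have h1 : |g c - a| * l ^ d ≤
      ε * l ^ d + (∫ x in halfOpenCube c l, |b x - g x|) + m * l ^ d := by
    calc |g c - a| * l ^ d = ∫ x in halfOpenCube c l, |g c - a| := (hint _).symm
      _ ≤ ∫ x in halfOpenCube c l, (ε + |b x - g x| + |b x - a|) := by
        refine setIntegral_mono_on (hconst _) (((hconst ε).add hbg).add hba)
          (measurableSet_halfOpenCube c l) fun x hx => ?_
        have := hc x hx
        have e : g c - a = -(g x - g c) - (b x - g x) + (b x - a) := by ring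
        rw [e]
        refine (abs_add_le _ _).trans (add_le_add ((abs_sub _ _).trans ?_) le_rfl)
        rw [abs_neg]; linarith
      _ = ε * l ^ d + (∫ x in halfOpenCube c l, |b x - g x|) +
          ∫ x in halfOpenCube c l, |b x - a| := by
        have hεbg : IntegrableOn (fun x => ε + |b x - g x|) (halfOpenCube c l) :=
          (hconst ε).add hbg
        rw [integral_add hεbg hba, integral_add (hconst ε) hbg, hint]
      _ ≤ _ := by linarith
  have hD : 0 ≤ ∫ x in halfOpenCube c l, |b x - g x| := integral_nonneg fun _ => abs_nonneg _
  have hε : 0 ≤ ε := (abs_nonneg _).trans (hc c fun i => ⟨le_rfl, by linarith⟩)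
  calc ∫ x in halfOpenCube c l, max (|b x - a| - T) 0
      ≤ ∫ x in halfOpenCube c l, (|b x - g x| + (ε + max (|g c - a| - m) 0)) := by
        refine setIntegral_mono_on ((hba.sub (hconst T)).pos_part) (hbg.add (hconst _))
          (measurableSet_halfOpenCube c l) fun x hx => ?_
        have h2 := hc x hx
        have e : b x - a = (b x - g x) + ((g x - g c) + (g c - a)) := by ring
        have h3 := (abs_add_le (b x - g x) ((g x - g c) + (g c - a))).trans
          (add_le_add le_rfl (abs_add_le _ _))
        rw [← e] at h3
        refine max_le ?_ (by positivity)
        linarith [le_max_left (|g c - a| - m) 0]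
    _ = (∫ x in halfOpenCube c l, |b x - g x|) +
          (ε * l ^ d + max (|g c - a| - m) 0 * l ^ d) := by
        rw [integral_add hbg (hconst _), hint, add_mul]
    _ ≤ _ := by
        have : max (|g c - a| - m) 0 * l ^ d ≤
            ε * l ^ d + ∫ x in halfOpenCube c l, |b x - g x| := by
          rcases max_cases (|g c - a| - m) 0 with ⟨h, _⟩ | ⟨h, _⟩ <;> rw [h]
          · rw [sub_mul]; linarith
          · rw [zero_mul]; positivity
        linarith

lemma integral_max_sub_le_of_stopping {d : ℕ} {b g : Rd d → ℝ}
    (hb : LocallyIntegrable b volume) (hg : Continuous g) {A t m ε δ a : ℝ} (hA0 : 0 ≤ A)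
    (ht : 0 ≤ t) (hm0 : 0 < m)
    (hA : ∀ (c : Rd d) (l : ℝ), 0 < l → ∫ x in halfOpenCube c l,
      max (|b x - ⨍ y in halfOpenCube c l, b y| - t) 0 ≤ A * l ^ d)
    (huc : ∀ x y, (∀ i, |x i - y i| ≤ δ) → |g x - g y| ≤ ε) (N : ℕ) :
    ∀ (c : Rd d) (l : ℝ), 0 < l → l ≤ 2 ^ N * δ →
      ∫ x in halfOpenCube c l, |b x - a| ≤ m * l ^ d →
      ∫ x in halfOpenCube c l, max (|b x - a| - (t + 2 ^ d * m)) 0 ≤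
        A / m * (∫ x in halfOpenCube c l, |b x - a|) +
          (2 * (∫ x in halfOpenCube c l, |b x - g x|) + 2 * ε * l ^ d) := by
  have hnn : ∀ (c : Rd d) (l : ℝ), 0 ≤ A / m * (∫ x in halfOpenCube c l, |b x - a|) :=
    fun c l => mul_nonneg (by positivity) (integral_nonneg fun _ => abs_nonneg _)
  induction N with
  | zero =>
    intro c l hl hlδ hm
    have h1 : (1:ℝ) ≤ 2 ^ d := one_le_pow₀ (by norm_num)
    have := integral_max_sub_le_of_uniform hb hg (T := t + 2 ^ d * m)
      (by nlinarith) huc c hl (by simpa using hlδ) hm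
    linarith [hnn c l]
  | succ N ih =>
    intro c l hl hlδ hm
    have hfin : ∀ (c : Rd d) {l : ℝ}, 0 < l → volume (halfOpenCube c l) ≠ ∞ := fun c l hl => by
      rw [volume_halfOpenCube c hl.le]; exact ENNReal.ofReal_ne_top
    have hba : ∀ (c : Rd d) {l : ℝ} (r : ℝ), 0 < l →
        IntegrableOn (fun x => |b x - r|) (halfOpenCube c l) := fun c l r hl =>
      ((integrableOn_halfOpenCube hb c l).sub (integrableOn_const (hfin c hl))).abs
    have hmax : ∀ (c : Rd d) {l : ℝ} (r T : ℝ), 0 < l →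
        IntegrableOn (fun x => max (|b x - r| - T) 0) (halfOpenCube c l) := fun c l r T hl =>
      ((hba c r hl).sub (integrableOn_const (hfin c hl))).pos_part
    have hbg : IntegrableOn (fun x => |b x - g x|) (halfOpenCube c l) :=
      ((integrableOn_halfOpenCube hb c l).sub
        (integrableOn_halfOpenCube hg.locallyIntegrable c l)).abs
    have hε : 0 ≤ ε := (abs_nonneg _).trans
      (huc c c fun i => by
        simp only [sub_self, abs_zero]
        exact (pos_of_mul_pos_right (hl.trans_le hlδ) (by positivity)).le)
    have hl2 : 0 < l / 2 := by positivity
    rw [setIntegral_halfOpenCube_eq_sum_child c hl (hmax c a _ hl),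
      setIntegral_halfOpenCube_eq_sum_child c hl (hba c a hl),
      setIntegral_halfOpenCube_eq_sum_child c hl hbg]
    have hvol : l ^ d = ∑ _e : Fin d → Bool, (l / 2) ^ d := by
      simp [div_pow]; field_simp
    rw [hvol, Finset.mul_sum, Finset.mul_sum, Finset.mul_sum, ← Finset.sum_add_distrib,
      ← Finset.sum_add_distrib]
    refine Finset.sum_le_sum fun e _ => ?_
    set c' := childCorner c l e
    by_cases h : ∫ x in halfOpenCube c' (l / 2), |b x - a| ≤ m * (l / 2) ^ d
    · exact ih c' (l / 2) hl2 (by rw [pow_succ] at hlδ; linarith) h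
    push Not at h
    have hsub : ∫ x in halfOpenCube c' (l / 2), |b x - a| ≤
        ∫ x in halfOpenCube c l, |b x - a| :=
      setIntegral_mono_set (hba c a hl) (ae_of_all _ fun _ => abs_nonneg _)
        (halfOpenCube_child_subset c hl e).eventuallyLE
    have havg := abs_average_sub_mul_le hb c' hl2 a
    have havg' : |(⨍ x in halfOpenCube c' (l / 2), b x) - a| ≤ 2 ^ d * m := by
      have : |(⨍ x in halfOpenCube c' (l / 2), b x) - a| * (l / 2) ^ d ≤
          2 ^ d * m * (l / 2) ^ d := by
        have e2 : 2 ^ d * m * (l / 2) ^ d = m * l ^ d := by rw [div_pow]; field_simp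
        linarith
      exact le_of_mul_le_mul_right this (by positivity)
    have h1 : ∫ x in halfOpenCube c' (l / 2), max (|b x - a| - (t + 2 ^ d * m)) 0 ≤
        A * (l / 2) ^ d := by
      refine le_trans (setIntegral_mono_on (hmax c' a _ hl2) (hmax c' _ t hl2)
        (measurableSet_halfOpenCube _ _) fun x _ => ?_) (hA c' (l / 2) hl2)
      have := abs_sub_le (b x) (⨍ x in halfOpenCube c' (l / 2), b x) a
      exact max_le_max (by linarith) le_rfl
    have h2 : A * (l / 2) ^ d ≤ A / m * ∫ x in halfOpenCube c' (l / 2), |b x - a| := by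
      rw [div_mul_eq_mul_div, le_div_iff₀ hm0]
      nlinarith
    have h3 : 0 ≤ ∫ x in halfOpenCube c' (l / 2), |b x - g x| :=
      integral_nonneg fun _ => abs_nonneg _
    have : 0 ≤ 2 * ε * (l / 2) ^ d := by positivity
    linarith

lemma exists_uniform_approx {d : ℕ} {b : Rd d → ℝ} (hb : LocallyIntegrable b volume)
    (c : Rd d) (l : ℝ) {ε : ℝ} (hε : 0 < ε) :
    ∃ g : Rd d → ℝ, Continuous g ∧ (∫ x in halfOpenCube c l, |b x - g x|) ≤ ε ∧
      ∃ δ > 0, ∀ x y, (∀ i, |x i - y i| ≤ δ) → |g x - g y| ≤ ε := by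
  have hQ := measurableSet_halfOpenCube c l
  have hf : Integrable ((halfOpenCube c l).indicator b) volume :=
    (integrable_indicator_iff hQ).2 (integrableOn_halfOpenCube hb c l)
  obtain ⟨g, hgc, hgε, hg, hgi⟩ := hf.exists_hasCompactSupport_integral_sub_le hε
  refine ⟨g, hg, ?_, ?_⟩
  · calc ∫ x in halfOpenCube c l, |b x - g x|
        = ∫ x in halfOpenCube c l, ‖(halfOpenCube c l).indicator b x - g x‖ :=
          setIntegral_congr_fun hQ fun x hx => by simp [hx]
      _ ≤ ∫ x, ‖(halfOpenCube c l).indicator b x - g x‖ :=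
          setIntegral_le_integral (hf.sub hgi).norm (ae_of_all _ fun _ => norm_nonneg _)
      _ ≤ ε := hgε
  · have huc : UniformContinuous fun u : Fin d → ℝ => g (WithLp.toLp 2 u) :=
      (hgc.uniformContinuous_of_continuous hg).comp (PiLp.uniformContinuous_toLp 2 _)
    obtain ⟨δ, hδ, h⟩ := Metric.uniformContinuous_iff.1 huc ε hε
    refine ⟨δ / 2, by positivity, fun x y hxy => ?_⟩
    have := h (a := WithLp.ofLp x) (b := WithLp.ofLp y)
      (lt_of_le_of_lt ((dist_pi_le_iff (by positivity)).2 hxy) (half_lt_self hδ))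
    exact this.le

/-- An exponential-decay form of the John–Nirenberg inequality. -/
lemma BMOBound.johnNirenberg {d : ℕ} {b : Rd d → ℝ} {M : ℝ} (hb : BMOBound b M) (hM : 0 ≤ M)
    (n : ℕ) (c : Rd d) {l : ℝ} (hl : 0 < l) :
    ∫ x in halfOpenCube c l,
      max (|b x - ⨍ y in halfOpenCube c l, b y| - n * (2 ^ d * (4 * M))) 0 ≤
        (1 / 4) ^ n * M * l ^ d := by
  rcases hM.eq_or_lt with rfl | hM0
  · have := hb.integral_halfOpenCube_le c hl
    simpa using this
  induction n generalizing c l with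
  | zero => simpa using hb.integral_halfOpenCube_le c hl
  | succ n ih =>
    have hlpos : 0 < l ^ d := by positivity
    set a := ⨍ y in halfOpenCube c l, b y
    have hosc : ∫ x in halfOpenCube c l, |b x - a| ≤ M * l ^ d :=
      hb.integral_halfOpenCube_le c hl
    refine le_of_forall_pos_le_add fun η hη => ?_
    have hε : 0 < η / (2 + 2 * l ^ d) := by positivity
    obtain ⟨g, hg, hbg, δ, hδ, huc⟩ := exists_uniform_approx hb.1 c l hε
    obtain ⟨N, hN⟩ := pow_unbounded_of_one_lt (l / δ) (one_lt_two (α := ℝ))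
    have key := integral_max_sub_le_of_stopping hb.1 hg (A := (1 / 4) ^ n * M)
      (t := n * (2 ^ d * (4 * M))) (m := 4 * M) (a := a) (by positivity) (by positivity)
      (by positivity) (fun c l hl => ih c hl) huc N c l hl ((div_le_iff₀ hδ).1 hN.le)
      (by nlinarith)
    have e1 : ((n + 1 : ℕ) : ℝ) * (2 ^ d * (4 * M)) =
        n * (2 ^ d * (4 * M)) + 2 ^ d * (4 * M) := by push_cast; ring
    have e2 : (1 / 4) ^ n * M / (4 * M) * (∫ x in halfOpenCube c l, |b x - a|) ≤
        (1 / 4) ^ (n + 1) * M * l ^ d := by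
      have : (1 / 4 : ℝ) ^ n * M / (4 * M) = (1 / 4) ^ (n + 1) := by
        rw [pow_succ]; field_simp
      rw [this, mul_assoc]
      gcongr
    have e3 : 2 * (η / (2 + 2 * l ^ d)) + 2 * (η / (2 + 2 * l ^ d)) * l ^ d = η := by
      field_simp
    rw [e1]
    linarith

/-- The lower corner of the cube concentric with the cube of corner `c` and side length `l`, and
`2 ^ k` times as large. -/
def dilatedCorner {d : ℕ} (c : Rd d) (l : ℝ) (k : ℕ) : Rd d :=
  WithLp.toLp 2 fun i => c i - (2 ^ k - 1) * l / 2

lemma halfOpenCube_dilated_subset_succ {d : ℕ} (c : Rd d) {l : ℝ} (hl : 0 < l) (k : ℕ) :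
    halfOpenCube (dilatedCorner c l k) (2 ^ k * l) ⊆
      halfOpenCube (dilatedCorner c l (k + 1)) (2 ^ (k + 1) * l) := by
  intro x hx i
  have h := hx i
  have : 0 < 2 ^ k * l := by positivity
  simp only [dilatedCorner, mem_Ico, pow_succ] at h ⊢
  constructor <;> nlinarith [h.1, h.2]

lemma dilatedCorner_zero {d : ℕ} (c : Rd d) (l : ℝ) : dilatedCorner c l 0 = c := by
  ext i; simp [dilatedCorner]

lemma BMOBound.abs_average_dilated_sub_le {d : ℕ} {b : Rd d → ℝ} {M : ℝ} (hb : BMOBound b M)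
    (c : Rd d) {l : ℝ} (hl : 0 < l) (k : ℕ) :
    |(⨍ x in halfOpenCube c l, b x) -
      ⨍ x in halfOpenCube (dilatedCorner c l k) (2 ^ k * l), b x| ≤ k * (2 ^ d * M) := by
  induction k with
  | zero => simp [dilatedCorner_zero]
  | succ k ih =>
    have hl1 : 0 < 2 ^ k * l := by positivity
    have hl2 : 0 < 2 ^ (k + 1) * l := by positivity
    have h1 := abs_average_sub_mul_le hb.1 (dilatedCorner c l k) hl1
      (⨍ x in halfOpenCube (dilatedCorner c l (k + 1)) (2 ^ (k + 1) * l), b x)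
    have h2 := hb.integral_halfOpenCube_le (dilatedCorner c l (k + 1)) hl2
    have hint : IntegrableOn (fun x => |b x -
        ⨍ x in halfOpenCube (dilatedCorner c l (k + 1)) (2 ^ (k + 1) * l), b x|)
        (halfOpenCube (dilatedCorner c l (k + 1)) (2 ^ (k + 1) * l)) :=
      ((integrableOn_halfOpenCube hb.1 _ _).sub (integrableOn_const (by
        rw [volume_halfOpenCube _ hl2.le]; exact ENNReal.ofReal_ne_top))).abs
    have h3 := setIntegral_mono_set hint (ae_of_all _ fun _ => abs_nonneg _)
      (halfOpenCube_dilated_subset_succ c hl k).eventuallyLE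
    have h4 : M * (2 ^ (k + 1) * l) ^ d = 2 ^ d * M * (2 ^ k * l) ^ d := by
      rw [pow_succ, mul_comm (2 ^ k) (2 : ℝ), mul_assoc, mul_pow 2]; ring
    have h5 := le_of_mul_le_mul_right ((h1.trans (h3.trans h2)).trans h4.le) (by positivity)
    have h6 := abs_sub_le (⨍ x in halfOpenCube c l, b x)
      (⨍ x in halfOpenCube (dilatedCorner c l k) (2 ^ k * l), b x)
      (⨍ x in halfOpenCube (dilatedCorner c l (k + 1)) (2 ^ (k + 1) * l), b x)
    push_cast
    linarith

lemma norm_normalize_sub_le {E : Type*} [NormedAddCommGroup E] [NormedSpace ℝ E] {x y : E}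
    (hx : 1 ≤ ‖x‖) (hy : y ≠ 0) : ‖‖x‖⁻¹ • x - ‖y‖⁻¹ • y‖ ≤ 2 * ‖x - y‖ := by
  have hx0 : 0 < ‖x‖ := by linarith
  have hy0 : 0 < ‖y‖ := norm_pos_iff.2 hy
  have e : ‖x‖⁻¹ • x - ‖y‖⁻¹ • y = ‖x‖⁻¹ • (x - y) + (‖x‖⁻¹ - ‖y‖⁻¹) • y := by
    rw [smul_sub, sub_smul]; abel
  have h1 : ‖‖x‖⁻¹ • (x - y)‖ ≤ ‖x - y‖ := by
    rw [norm_smul, norm_inv, norm_norm]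
    exact mul_le_of_le_one_left (norm_nonneg _) (inv_le_one_of_one_le₀ hx)
  have h2 : ‖(‖x‖⁻¹ - ‖y‖⁻¹) • y‖ ≤ ‖x - y‖ := by
    have : ‖x‖⁻¹ - ‖y‖⁻¹ = (‖y‖ - ‖x‖) * (‖x‖⁻¹ * ‖y‖⁻¹) := by field_simp
    rw [norm_smul, this, Real.norm_eq_abs, abs_mul, abs_of_pos (by positivity : 0 < ‖x‖⁻¹ * ‖y‖⁻¹),
      mul_assoc, mul_assoc, inv_mul_cancel₀ hy0.ne', mul_one]
    calc |‖y‖ - ‖x‖| * ‖x‖⁻¹ ≤ |‖y‖ - ‖x‖| :=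
          mul_le_of_le_one_right (abs_nonneg _) (inv_le_one_of_one_le₀ hx)
      _ ≤ ‖x - y‖ := by rw [norm_sub_rev]; exact abs_norm_sub_norm_le y x
  rw [e]
  linarith [norm_add_le (‖x‖⁻¹ • (x - y)) ((‖x‖⁻¹ - ‖y‖⁻¹) • y)]

/-- The central projection of a face of the cube `[-1, 1] ^ (n + 1)` to the sphere. -/
def faceProj {n : ℕ} (k : Fin (n + 1)) (r : ℝ) (u : Fin n → ℝ) : Rd (n + 1) :=
  ‖(WithLp.toLp 2 (k.insertNth r u : Fin (n + 1) → ℝ) : Rd (n + 1))‖⁻¹ •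
    (WithLp.toLp 2 (k.insertNth r u : Fin (n + 1) → ℝ) : Rd (n + 1))

lemma exists_lipschitzWith_faceProj {n : ℕ} (k : Fin (n + 1)) {r : ℝ} (hr : |r| = 1) :
    ∃ K : ℝ≥0, LipschitzWith K (faceProj k r) := by
  have hone : ∀ u : Fin n → ℝ,
      1 ≤ ‖(WithLp.toLp 2 (k.insertNth r u : Fin (n + 1) → ℝ) : Rd (n + 1))‖ := fun u => by
    have := PiLp.norm_apply_le
      (WithLp.toLp 2 (k.insertNth r u : Fin (n + 1) → ℝ) : Rd (n + 1)) k
    simpa [hr] using this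
  obtain ⟨K, hK⟩ : ∃ K : ℝ≥0, LipschitzWith K
      (WithLp.toLp 2 : (Fin (n + 1) → ℝ) → Rd (n + 1)) := ⟨_, PiLp.lipschitzWith_toLp 2 _⟩
  refine ⟨2 * K, LipschitzWith.of_dist_le_mul fun u v => ?_⟩
  have h1 : dist (k.insertNth r u : Fin (n + 1) → ℝ) (k.insertNth r v : Fin (n + 1) → ℝ) ≤
      dist u v := by
    refine (dist_pi_le_iff dist_nonneg).2 fun m => ?_
    induction m using Fin.succAboveCases k with
    | x => simp
    | p m => simpa using dist_le_pi_dist u v m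
  have h2 := hK.dist_le_mul (k.insertNth r u) (k.insertNth r v)
  have h3 := norm_normalize_sub_le (hone u) (norm_pos_iff.1 (one_pos.trans_le (hone v)))
  rw [← dist_eq_norm, ← dist_eq_norm] at h3
  calc dist (faceProj k r u) (faceProj k r v) ≤ _ := h3
    _ ≤ 2 * (K * dist (k.insertNth r u : Fin (n + 1) → ℝ) (k.insertNth r v)) := by gcongr
    _ ≤ 2 * (K * dist u v) := by gcongr
    _ = _ := by push_cast; ring

lemma sphere_subset_iUnion_faceProj (n : ℕ) :
    sphere (0 : Rd (n + 1)) 1 ⊆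
      ⋃ (k : Fin (n + 1)) (p : Bool), faceProj k (if p then 1 else -1) '' Icc (-1) 1 := by
  intro x hx
  have hx1 : ‖x‖ = 1 := by simpa using hx
  obtain ⟨k, -, hk⟩ := Finset.exists_max_image Finset.univ (fun i => |x i|) Finset.univ_nonempty
  have hk0 : 0 < |x k| := by
    by_contra! h
    have : x = 0 := by
      ext i
      exact abs_nonpos_iff.1 ((hk i (Finset.mem_univ i)).trans h)
    simp [this] at hx1
  simp only [mem_iUnion]
  refine ⟨k, decide (0 < x k), fun m => |x k|⁻¹ * x (k.succAbove m), ?_, ?_⟩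
  · have hb : ∀ m, |(|x k|⁻¹ * x (k.succAbove m))| ≤ 1 := fun m => by
      rw [abs_mul, abs_inv, abs_abs, inv_mul_le_iff₀ hk0, mul_one]
      exact hk _ (Finset.mem_univ _)
    exact ⟨fun m => (abs_le.1 (hb m)).1, fun m => (abs_le.1 (hb m)).2⟩
  · have e : (WithLp.toLp 2 (k.insertNth (if decide (0 < x k) then (1 : ℝ) else -1)
        (fun m => |x k|⁻¹ * x (k.succAbove m)) : Fin (n + 1) → ℝ) : Rd (n + 1)) =
        |x k|⁻¹ • x := by
      ext m
      induction m using Fin.succAboveCases k with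
      | x =>
        rcases lt_or_ge 0 (x k) with h | h
        · simp [h, abs_of_pos h, h.ne']
        · have h' : x k ≠ 0 := abs_pos.1 hk0
          simp [not_lt.2 h, abs_of_nonpos h, h']
      | p m => simp
    rw [faceProj, e, norm_smul, hx1, mul_one, norm_inv, Real.norm_eq_abs, abs_abs, inv_inv,
      smul_smul, mul_inv_cancel₀ hk0.ne', one_smul]

lemma sphereMeasure_ne_top (n : ℕ) : sphereMeasure (n + 1) univ ≠ ∞ := by
  rw [sphereMeasure, Measure.restrict_apply_univ]
  have hdim : (((n + 1 : ℕ) : ℝ) - 1) = n := by push_cast; ring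
  rw [hdim]
  refine ((measure_mono (sphere_subset_iUnion_faceProj n)).trans
    (measure_iUnion_le _)).trans_lt ?_ |>.ne
  rw [tsum_fintype]
  refine ENNReal.sum_lt_top.2 fun k _ => (measure_iUnion_le _).trans_lt ?_
  rw [tsum_fintype]
  refine ENNReal.sum_lt_top.2 fun p _ => ?_
  obtain ⟨K, hK⟩ := exists_lipschitzWith_faceProj k (r := if p then 1 else -1)
    (by cases p <;> simp)
  refine (hK.hausdorffMeasure_image_le (Nat.cast_nonneg n) _).trans_lt ?_
  have hv : (μH[(n : ℝ)] : Measure (Fin n → ℝ)) = volume := by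
    simpa using hausdorffMeasure_pi_real (ι := Fin n)
  rw [hv]
  exact ENNReal.mul_lt_top (by simp) isCompact_Icc.measure_lt_top

/-- The annulus `ρ / 2 ≤ ‖x‖ ≤ 2 ρ`. -/
def annulus (d : ℕ) (ρ : ℝ) : Set (Rd d) := {x | ρ / 2 ≤ ‖x‖ ∧ ‖x‖ ≤ 2 * ρ}

lemma measurableSet_annulus (d : ℕ) (ρ : ℝ) : MeasurableSet (annulus d ρ) :=
  (measurableSet_le measurable_const measurable_norm).inter
    (measurableSet_le measurable_norm measurable_const)

lemma measurable_normalize (d : ℕ) : Measurable fun x : Rd d => ‖x‖⁻¹ • x :=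
  measurable_norm.inv.smul measurable_id

/-- The volume of the part of an annulus that lies in the cone over a set of diameter at
most `δ`. -/
lemma volume_annulus_inter_cone_le {n : ℕ} {ρ δ : ℝ} (hρ : 0 < ρ) (hδ : 0 < δ) (hδ1 : δ ≤ 1)
    {s : Set (Rd (n + 1))} (hs : ∀ x ∈ s, ∀ y ∈ s, dist x y ≤ δ) :
    volume (annulus (n + 1) ρ ∩ (fun x => ‖x‖⁻¹ • x) ⁻¹' s) ≤
      ENNReal.ofReal (3 ^ (n + 2) * ρ ^ (n + 1) * δ ^ n) * volume (ball (0 : Rd (n + 1)) 1) := by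
  rcases (annulus (n + 1) ρ ∩ (fun x => ‖x‖⁻¹ • x) ⁻¹' s).eq_empty_or_nonempty with h | h
  · simp [h]
  obtain ⟨x₀, hx₀, hx₀s⟩ := h
  set θ := ‖x₀‖⁻¹ • x₀ with hθ
  have hθ1 : ‖θ‖ = 1 := by
    have : 0 < ‖x₀‖ := by linarith [hx₀.1]
    rw [hθ, norm_smul, norm_inv, norm_norm, inv_mul_cancel₀ this.ne']
  have hsub : annulus (n + 1) ρ ∩ (fun x => ‖x‖⁻¹ • x) ⁻¹' s ⊆
      ⋃ k ∈ Finset.range (⌊2 / δ⌋₊ + 1), closedBall ((k * (ρ * δ)) • θ) (3 * ρ * δ) := by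
    rintro x ⟨hx, hxs⟩
    have hx0 : 0 < ‖x‖ := by linarith [hx.1]
    have hρδ : 0 < ρ * δ := by positivity
    have hk1 := Nat.floor_le (a := ‖x‖ / (ρ * δ)) (by positivity)
    have hk2 := Nat.lt_floor_add_one (‖x‖ / (ρ * δ))
    have hk3 : ⌊‖x‖ / (ρ * δ)⌋₊ ≤ ⌊2 / δ⌋₊ := by
      refine Nat.floor_mono ?_
      rw [div_le_div_iff₀ hρδ hδ]
      nlinarith [hx.2]
    refine mem_iUnion₂.2 ⟨⌊‖x‖ / (ρ * δ)⌋₊, Finset.mem_range.2 (by omega), ?_⟩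
    set k := ⌊‖x‖ / (ρ * δ)⌋₊
    rw [le_div_iff₀ hρδ] at hk1
    rw [div_lt_iff₀ hρδ] at hk2
    have e : x - (k * (ρ * δ)) • θ = ‖x‖ • (‖x‖⁻¹ • x - θ) + (‖x‖ - k * (ρ * δ)) • θ := by
      rw [smul_sub, sub_smul, smul_inv_smul₀ hx0.ne']; abel
    have h1 : ‖‖x‖⁻¹ • x - θ‖ ≤ δ := by
      rw [← dist_eq_norm]; exact hs _ hxs _ hx₀s
    rw [mem_closedBall, dist_eq_norm, e]
    refine (norm_add_le _ _).trans ?_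
    rw [norm_smul, norm_smul, hθ1, norm_norm, mul_one, Real.norm_eq_abs, abs_of_nonneg (by linarith)]
    have h2 : ‖x‖ * ‖‖x‖⁻¹ • x - θ‖ ≤ 2 * ρ * δ := by
      have := hx.2
      gcongr
    linarith
  refine (measure_mono hsub).trans ((measure_biUnion_finset_le _ _).trans ?_)
  have hball : ∀ k ∈ Finset.range (⌊2 / δ⌋₊ + 1),
      volume (closedBall ((k * (ρ * δ)) • θ) (3 * ρ * δ)) =
        ENNReal.ofReal ((3 * ρ * δ) ^ (n + 1)) * volume (ball (0 : Rd (n + 1)) 1) := fun k _ => by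
    rw [Measure.addHaar_closedBall _ _ (by positivity)]
    simp
  rw [Finset.sum_congr rfl hball, Finset.sum_const, nsmul_eq_mul, ← mul_assoc, Finset.card_range,
    ← ENNReal.ofReal_natCast, ← ENNReal.ofReal_mul (by positivity)]
  refine mul_le_mul' (ENNReal.ofReal_le_ofReal ?_) le_rfl
  have h1 : ((⌊2 / δ⌋₊ + 1 : ℕ) : ℝ) ≤ 3 / δ := by
    have := Nat.floor_le (a := 2 / δ) (by positivity)
    have h2 : 1 ≤ 1 / δ := by rw [le_div_iff₀ hδ]; linarith
    have h3 : 3 / δ = 2 / δ + 1 / δ := by ring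
    push_cast; linarith
  calc ((⌊2 / δ⌋₊ + 1 : ℕ) : ℝ) * (3 * ρ * δ) ^ (n + 1)
      ≤ 3 / δ * (3 * ρ * δ) ^ (n + 1) := by gcongr
    _ = 3 ^ (n + 2) * ρ ^ (n + 1) * δ ^ n := by
      rw [mul_pow, mul_pow]; field_simp; ring

/-- The constant comparing Lebesgue measure on an annulus with the surface measure. -/
def annulusConst (d : ℕ) : ℝ := 3 ^ (d + 1) * volume.real (ball (0 : Rd d) 1)

lemma annulusConst_pos (d : ℕ) : 0 < annulusConst d :=
  mul_pos (by positivity)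
    (ENNReal.toReal_pos (measure_ball_pos volume 0 one_pos).ne' measure_ball_lt_top.ne)

lemma map_normalize_annulus_le_hausdorff (n : ℕ) {ρ : ℝ} (hρ : 0 < ρ) :
    (volume.restrict (annulus (n + 1) ρ)).map (fun x => ‖x‖⁻¹ • x) ≤
      ENNReal.ofReal (annulusConst (n + 1) * ρ ^ (n + 1)) • μH[(n : ℝ)] := by
  set κ := ENNReal.ofReal (annulusConst (n + 1) * ρ ^ (n + 1)) with hκ
  have hκ0 : κ ≠ 0 := by
    have := annulusConst_pos (n + 1)
    rw [hκ, Ne, ENNReal.ofReal_eq_zero, not_le]; positivity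
  have hκt : κ ≠ ∞ := ENNReal.ofReal_ne_top
  set ν := (volume.restrict (annulus (n + 1) ρ)).map (fun x => ‖x‖⁻¹ • x) with hν
  have hle : κ⁻¹ • ν ≤ μH[(n : ℝ)] := by
    refine Measure.le_hausdorffMeasure _ _ 1 one_pos fun s hs => ?_
    have hst : ediam s ≠ ∞ := (hs.trans_lt ENNReal.one_lt_top).ne
    have hdist : ∀ x ∈ closure s, ∀ y ∈ closure s, dist x y ≤ (ediam s).toReal :=
      fun x hx y hy => by
        rw [dist_edist]
        refine ENNReal.toReal_mono hst ?_
        rw [← ediam_closure s]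
        exact edist_le_ediam_of_mem hx hy
    have hD1 : (ediam s).toReal ≤ 1 := by
      simpa using ENNReal.toReal_mono ENNReal.one_ne_top hs
    have hbound : ∀ δ : ℝ, 0 < δ → δ ≤ 1 → (ediam s).toReal ≤ δ →
        ν s ≤ κ * ENNReal.ofReal (δ ^ n) := fun δ hδ hδ1 hD => by
      calc ν s ≤ ν (closure s) := measure_mono subset_closure
        _ = volume (annulus (n + 1) ρ ∩ (fun x => ‖x‖⁻¹ • x) ⁻¹' closure s) := by
          rw [hν, Measure.map_apply (measurable_normalize _) isClosed_closure.measurableSet,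
            Measure.restrict_apply (measurable_normalize _ isClosed_closure.measurableSet),
            inter_comm]
        _ ≤ _ := volume_annulus_inter_cone_le hρ hδ hδ1
          fun x hx y hy => (hdist x hx y hy).trans hD
        _ = κ * ENNReal.ofReal (δ ^ n) := by
          rw [hκ, annulusConst, Measure.real, ENNReal.ofReal_mul (by positivity),
            ENNReal.ofReal_mul (by positivity), ENNReal.ofReal_mul (by positivity),
            ENNReal.ofReal_mul (by positivity), ENNReal.ofReal_toReal measure_ball_lt_top.ne]
          ring
    have hlim : Tendsto (fun k : ℕ => κ * ENNReal.ofReal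
        ((max (ediam s).toReal (1 / ((k : ℝ) + 1))) ^ n)) atTop
        (𝓝 (κ * ENNReal.ofReal ((max (ediam s).toReal 0) ^ n))) :=
      ENNReal.Tendsto.const_mul (ENNReal.tendsto_ofReal
        ((tendsto_const_nhds.max tendsto_one_div_add_atTop_nhds_zero_nat).pow n)) (Or.inr hκt)
    have hνs : ν s ≤ κ * ENNReal.ofReal ((max (ediam s).toReal 0) ^ n) := by
      refine ge_of_tendsto' hlim fun k => hbound _ ?_ ?_ (le_max_left _ _)
      · exact lt_max_of_lt_right (by positivity)
      · refine max_le hD1 ?_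
        rw [div_le_one (by positivity)]
        linarith [k.cast_nonneg (α := ℝ)]
    rw [max_eq_left ENNReal.toReal_nonneg, ENNReal.ofReal_pow ENNReal.toReal_nonneg,
      ENNReal.ofReal_toReal hst] at hνs
    rw [Measure.smul_apply, smul_eq_mul, ENNReal.rpow_natCast]
    calc κ⁻¹ * ν s ≤ κ⁻¹ * (κ * ediam s ^ n) := by gcongr
      _ = _ := by rw [← mul_assoc, ENNReal.inv_mul_cancel hκ0 hκt, one_mul]
  intro s
  calc ν s = κ * ((κ⁻¹ • ν) s) := by
        rw [Measure.smul_apply, smul_eq_mul, ← mul_assoc, ENNReal.mul_inv_cancel hκ0 hκt, one_mul]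
    _ ≤ κ * μH[(n : ℝ)] s := by gcongr
    _ = _ := rfl

lemma map_normalize_annulus_le (n : ℕ) {ρ : ℝ} (hρ : 0 < ρ) :
    (volume.restrict (annulus (n + 1) ρ)).map (fun x => ‖x‖⁻¹ • x) ≤
      ENNReal.ofReal (annulusConst (n + 1) * ρ ^ (n + 1)) • sphereMeasure (n + 1) := by
  have hdim : (((n + 1 : ℕ) : ℝ) - 1) = n := by push_cast; ring
  have hae : ∀ᵐ θ ∂(volume.restrict (annulus (n + 1) ρ)).map (fun x => ‖x‖⁻¹ • x),
      θ ∈ sphere (0 : Rd (n + 1)) 1 := by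
    refine (ae_map_iff (p := (· ∈ sphere (0 : Rd (n + 1)) 1))
      (measurable_normalize _).aemeasurable isClosed_sphere.measurableSet).2 ?_
    refine (ae_restrict_iff' (measurableSet_annulus _ _)).2 (ae_of_all _ fun x hx => ?_)
    have : 0 < ‖x‖ := by linarith [hx.1]
    rw [mem_sphere_zero_iff_norm, norm_smul, norm_inv, norm_norm, inv_mul_cancel₀ this.ne']
  rw [sphereMeasure, hdim, ← Measure.restrict_smul, ← Measure.restrict_eq_self_of_ae_mem hae]
  exact Measure.restrict_mono le_rfl (map_normalize_annulus_le_hausdorff n hρ)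

lemma lintegral_annulus_normalize_le (n : ℕ) {ρ : ℝ} (hρ : 0 < ρ) {F : Rd (n + 1) → ℝ≥0∞}
    (hF : Measurable F) :
    ∫⁻ x in annulus (n + 1) ρ, F (‖x‖⁻¹ • x) ≤
      ENNReal.ofReal (annulusConst (n + 1) * ρ ^ (n + 1)) *
        ∫⁻ θ, F θ ∂(sphereMeasure (n + 1)) := by
  rw [← lintegral_map hF (measurable_normalize _), ← smul_eq_mul, ← lintegral_smul_measure]
  exact lintegral_mono' (map_normalize_annulus_le n hρ) le_rfl

lemma ae_annulus_normalize (n : ℕ) {ρ : ℝ} (hρ : 0 < ρ) {p : Rd (n + 1) → Prop}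
    (hp : ∀ᵐ θ ∂(sphereMeasure (n + 1)), p θ) :
    ∀ᵐ x : Rd (n + 1), x ∈ annulus (n + 1) ρ → p (‖x‖⁻¹ • x) := by
  have h1 : ∀ᵐ θ ∂(volume.restrict (annulus (n + 1) ρ)).map (fun x => ‖x‖⁻¹ • x), p θ :=
    (Measure.absolutelyContinuous_of_le (map_normalize_annulus_le n hρ)).trans
      Measure.smul_absolutelyContinuous hp
  exact (ae_restrict_iff' (measurableSet_annulus _ _)).1
    (ae_of_ae_map (measurable_normalize _).aemeasurable h1)

lemma PhiCutoff.le_one {d : ℕ} {φ : Rd d → ℝ} (hφ : PhiCutoff φ) (x : Rd d) : φ x ≤ 1 := by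
  obtain ⟨-, hnn, -, hsupp, hsum⟩ := hφ
  by_cases hx : x = 0
  · have : φ x = 0 := by
      by_contra h
      have := (hsupp h).1
      norm_num [hx] at this
    linarith
  · simpa using le_hasSum (hsum x hx) 0 fun j _ => hnn _

lemma measurable_Kj {d : ℕ} {Ω φ : Rd d → ℝ} (hΩ : Measurable Ω) (hφ : PhiCutoff φ) (j : ℤ) :
    Measurable (Kj Ω φ j) :=
  ((hΩ.comp (measurable_normalize d)).div (measurable_norm.pow_const d)).mul
    (hφ.1.continuous.measurable.comp (measurable_const_smul _))

lemma enorm_Kj_le {d : ℕ} {Ω φ : Rd d → ℝ} (hφ : PhiCutoff φ) (j : ℤ) (x : Rd d) :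
    ‖Kj Ω φ j x‖ₑ ≤ (annulus d ((2:ℝ) ^ j)).indicator
      (fun x => ENNReal.ofReal (2 ^ d / ((2:ℝ) ^ j) ^ d) * ‖Ω (‖x‖⁻¹ • x)‖ₑ) x := by
  have hρ : (0:ℝ) < 2 ^ j := by positivity
  by_cases h0 : φ ((2:ℝ) ^ (-j) • x) = 0
  · rw [Kj, h0, mul_zero, enorm_zero]
    exact zero_le
  have hx : x ∈ annulus d ((2:ℝ) ^ j) := by
    have h := hφ.2.2.2.1 h0
    simp only [mem_ofPred_eq, norm_smul, zpow_neg, norm_inv, Real.norm_eq_abs, abs_of_pos hρ] at h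
    rw [le_inv_mul_iff₀ hρ, inv_mul_le_iff₀ hρ] at h
    exact ⟨by linarith [h.1], by linarith [h.2]⟩
  rw [indicator_of_mem hx, Real.enorm_eq_ofReal_abs, Real.enorm_eq_ofReal_abs,
    ← ENNReal.ofReal_mul (by positivity)]
  refine ENNReal.ofReal_le_ofReal ?_
  have hx0 : 0 < ‖x‖ := by linarith [hx.1]
  have h1 : 1 / ‖x‖ ^ d ≤ 2 ^ d / ((2:ℝ) ^ j) ^ d := by
    rw [div_le_div_iff₀ (by positivity) (by positivity), one_mul, ← mul_pow]
    exact pow_le_pow_left₀ hρ.le (by linarith [hx.1]) d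
  rw [Kj, abs_mul, abs_div, abs_of_nonneg (hφ.2.1 _), abs_of_pos (pow_pos hx0 d)]
  calc |Ω (‖x‖⁻¹ • x)| / ‖x‖ ^ d * φ ((2:ℝ) ^ (-j) • x)
      ≤ |Ω (‖x‖⁻¹ • x)| / ‖x‖ ^ d * 1 := by
        gcongr
        exact hφ.le_one _
    _ = 1 / ‖x‖ ^ d * |Ω (‖x‖⁻¹ • x)| := by ring
    _ ≤ _ := by gcongr

lemma ofReal_integral_abs_sphere {n : ℕ} {Ω : Rd (n + 1) → ℝ} (hΩ : Measurable Ω) {B : ℝ}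
    (hB : ∀ᵐ θ ∂(sphereMeasure (n + 1)), |Ω θ| ≤ B) :
    ENNReal.ofReal (∫ θ, |Ω θ| ∂(sphereMeasure (n + 1))) =
      ∫⁻ θ, ‖Ω θ‖ₑ ∂(sphereMeasure (n + 1)) := by
  have : IsFiniteMeasure (sphereMeasure (n + 1)) := ⟨(sphereMeasure_ne_top n).lt_top⟩
  exact ofReal_integral_norm_eq_lintegral_enorm
    (Integrable.of_bound hΩ.aestronglyMeasurable B hB)

lemma mem_dilated_of_sub_mem_annulus {d : ℕ} {c x y : Rd d} {j : ℤ} {s : ℕ}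
    (hy : ∀ i, y i ∈ Icc (c i) (c i + (2:ℝ) ^ (j - (s:ℤ))))
    (hxy : x - y ∈ annulus d ((2:ℝ) ^ j)) :
    x ∈ halfOpenCube (dilatedCorner c ((2:ℝ) ^ (j - (s:ℤ))) (s + 3))
      (2 ^ (s + 3) * (2:ℝ) ^ (j - (s:ℤ))) := by
  intro i
  have hρ : (0:ℝ) < 2 ^ j := by positivity
  have hl : (0:ℝ) < 2 ^ (j - (s:ℤ)) := by positivity
  have h1 : (2:ℝ) ^ s * 2 ^ (j - (s:ℤ)) = 2 ^ j := by
    rw [← zpow_natCast, ← zpow_add₀ two_ne_zero]; congr 1; ring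
  have h2 : (2:ℝ) ^ (j - (s:ℤ)) ≤ 2 ^ j := by
    have : (1:ℝ) ≤ 2 ^ s := one_le_pow₀ (by norm_num)
    nlinarith
  have h3 := (PiLp.norm_apply_le (x - y) i).trans hxy.2
  rw [PiLp.sub_apply, Real.norm_eq_abs, abs_le] at h3
  have h4 := hy i
  simp only [dilatedCorner, mem_Icc, mem_Ico, pow_add] at h4 ⊢
  constructor <;> nlinarith [h3.1, h3.2, h4.1, h4.2]

/-- The oscillation of a `BMO` function integrated against a translate of the rough kernel. -/
lemma lintegral_oscillation_mul_Kj_le {n : ℕ} {φ Ω b : Rd (n + 1) → ℝ} (hφ : PhiCutoff φ)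
    (hΩ : Measurable Ω) {i : ℕ} (hΩi : ∀ᵐ θ ∂(sphereMeasure (n + 1)), |Ω θ| ≤ 2 ^ i)
    {j : ℤ} {s : ℕ} (hs : 1 ≤ s) {M : ℝ} (hb : BMOBound b M) (hM : 0 ≤ M) {c y : Rd (n + 1)}
    (hy : ∀ k, y k ∈ Icc (c k) (c k + (2:ℝ) ^ (j - (s:ℤ)))) :
    ∫⁻ x, ‖b x - ⨍ z in halfOpenCube c ((2:ℝ) ^ (j - (s:ℤ))), b z‖ₑ * ‖Kj Ω φ j (x - y)‖ₑ ≤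
      ENNReal.ofReal ((16 ^ (n + 1) + 4 * 4 ^ (n + 1) * annulusConst (n + 1)) * M *
        ((2:ℝ) ^ (-(i:ℤ)) + ((i:ℝ) + s) * ∫ θ, |Ω θ| ∂(sphereMeasure (n + 1)))) := by
  set l : ℝ := (2:ℝ) ^ (j - (s:ℤ)) with hl
  have hl0 : 0 < l := by positivity
  set ρ : ℝ := (2:ℝ) ^ j with hρ
  have hρ0 : 0 < ρ := by positivity
  have hLρ : 2 ^ (s + 3) * l = 8 * ρ := by
    have : (2:ℝ) ^ s * l = ρ := by
      rw [hl, hρ, ← zpow_natCast, ← zpow_add₀ two_ne_zero]; congr 1; ring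
    rw [pow_add]; linarith
  set I := ∫ θ, |Ω θ| ∂(sphereMeasure (n + 1)) with hI
  have hI0 : 0 ≤ I := integral_nonneg fun _ => abs_nonneg _
  have hA := annulusConst_pos (n + 1)
  set H := halfOpenCube (dilatedCorner c l (s + 3)) (2 ^ (s + 3) * l)
  have hL0 : 0 < 2 ^ (s + 3) * l := by positivity
  set a := ⨍ z in halfOpenCube c l, b z
  set m := ⨍ z in H, b z
  set T : ℝ := i * (2 ^ (n + 1) * (4 * M))
  set E : ℝ := 4 * 2 ^ (n + 1) * M * (i + s)
  have hE : 0 ≤ E := by positivity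
  set κ : ℝ := 2 ^ (n + 1) / ρ ^ (n + 1)
  have hκ : 0 ≤ κ := by positivity
  set W : Rd (n + 1) → ℝ := fun x => max (|b x - m| - T) 0
  have hW0 : ∀ x, 0 ≤ W x := fun x => le_max_right _ _
  have hWint : IntegrableOn W H :=
    (((integrableOn_halfOpenCube hb.1 _ _).sub (integrableOn_const (by
      rw [volume_halfOpenCube _ hL0.le]; exact ENNReal.ofReal_ne_top))).abs.sub
      (integrableOn_const (by
        rw [volume_halfOpenCube _ hL0.le]; exact ENNReal.ofReal_ne_top))).pos_part
  have ham : |a - m| ≤ ((s + 3 : ℕ) : ℝ) * (2 ^ (n + 1) * M) :=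
    hb.abs_average_dilated_sub_le c hl0 (s + 3)
  have hosc : ∀ x, |b x - a| ≤ W x + E := fun x => by
    have h1 := abs_sub_le (b x) m a
    rw [abs_sub_comm m a] at h1
    have h2 : |b x - m| - T ≤ W x := le_max_left _ _
    have h3 : T + ((s + 3 : ℕ) : ℝ) * (2 ^ (n + 1) * M) ≤ E := by
      have h4 : ((s + 3 : ℕ) : ℝ) ≤ 4 * s := by exact_mod_cast (by omega)
      have h5 : 0 ≤ 2 ^ (n + 1) * M := by positivity
      calc _ ≤ T + 4 * s * (2 ^ (n + 1) * M) := by gcongr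
        _ = E := by simp only [T, E]; ring
    linarith
  set k : Rd (n + 1) → ℝ≥0∞ := (annulus (n + 1) ρ).indicator
    (fun x => ENNReal.ofReal κ * ‖Ω (‖x‖⁻¹ • x)‖ₑ)
  have hΩN : Measurable fun x : Rd (n + 1) => ‖Ω (‖x‖⁻¹ • x)‖ₑ :=
    (hΩ.comp (measurable_normalize _)).enorm
  have hk : Measurable k := (hΩN.const_mul _).indicator (measurableSet_annulus _ _)
  have hae : ∀ᵐ x : Rd (n + 1), x - y ∈ annulus (n + 1) ρ →
      |Ω (‖x - y‖⁻¹ • (x - y))| ≤ 2 ^ i :=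
    (measurePreserving_sub_right volume y).quasiMeasurePreserving.ae
      (ae_annulus_normalize n hρ0 hΩi)
  have hpt : ∀ᵐ x : Rd (n + 1), ‖b x - a‖ₑ * ‖Kj Ω φ j (x - y)‖ₑ ≤
      H.indicator (fun x => ENNReal.ofReal (W x)) x * ENNReal.ofReal (κ * 2 ^ i) +
        ENNReal.ofReal E * k (x - y) := by
    filter_upwards [hae] with x hx
    by_cases hxy : x - y ∈ annulus (n + 1) ρ
    · have hxH : x ∈ H := mem_dilated_of_sub_mem_annulus hy hxy
      have hk1 : ‖Kj Ω φ j (x - y)‖ₑ ≤ k (x - y) := enorm_Kj_le hφ j (x - y)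
      have hk2 : k (x - y) ≤ ENNReal.ofReal (κ * 2 ^ i) := by
        simp only [k, indicator_of_mem hxy]
        rw [ENNReal.ofReal_mul hκ, Real.enorm_eq_ofReal_abs]
        gcongr
        exact hx hxy
      have h1 : ‖b x - a‖ₑ ≤ ENNReal.ofReal (W x) + ENNReal.ofReal E := by
        rw [Real.enorm_eq_ofReal_abs, ← ENNReal.ofReal_add (hW0 x) hE]
        exact ENNReal.ofReal_le_ofReal (hosc x)
      rw [indicator_of_mem hxH]
      calc _ ≤ (ENNReal.ofReal (W x) + ENNReal.ofReal E) * k (x - y) := by gcongr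
        _ ≤ _ := by rw [add_mul]; gcongr
    · have : ‖Kj Ω φ j (x - y)‖ₑ = 0 :=
        le_antisymm ((enorm_Kj_le hφ j (x - y)).trans_eq (indicator_of_notMem hxy _)) zero_le
      simp [this]
  have hfirst : ∫⁻ x, H.indicator (fun x => ENNReal.ofReal (W x)) x * ENNReal.ofReal (κ * 2 ^ i) ≤
      ENNReal.ofReal (16 ^ (n + 1) * M * (2:ℝ) ^ (-(i:ℤ))) := by
    rw [lintegral_mul_const' _ _ ENNReal.ofReal_ne_top,
      lintegral_indicator (measurableSet_halfOpenCube _ _),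
      ← ofReal_integral_eq_lintegral_ofReal hWint (ae_of_all _ hW0),
      ← ENNReal.ofReal_mul (integral_nonneg hW0)]
    refine ENNReal.ofReal_le_ofReal ?_
    have h1 : ∫ x in H, W x ≤ (1 / 4) ^ i * M * (2 ^ (s + 3) * l) ^ (n + 1) :=
      hb.johnNirenberg hM i _ hL0
    have e1 : (1 / 4 : ℝ) ^ i * 2 ^ i = (2:ℝ) ^ (-(i:ℤ)) := by
      rw [← mul_pow, zpow_neg, zpow_natCast, ← inv_pow]; norm_num
    have e2 : (16 : ℝ) ^ (n + 1) = 8 ^ (n + 1) * 2 ^ (n + 1) := by rw [← mul_pow]; norm_num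
    calc (∫ x in H, W x) * (κ * 2 ^ i)
        ≤ (1 / 4) ^ i * M * (8 * ρ) ^ (n + 1) * (κ * 2 ^ i) := by rw [← hLρ]; gcongr
      _ = 16 ^ (n + 1) * M * (2:ℝ) ^ (-(i:ℤ)) := by
        rw [← e1, e2, mul_pow 8 ρ]; simp only [κ]; field_simp
  have hsecond : ∫⁻ x, ENNReal.ofReal E * k (x - y) ≤
      ENNReal.ofReal (4 * 4 ^ (n + 1) * annulusConst (n + 1) * M * ((i + s) * I)) := by
    rw [lintegral_const_mul' _ _ ENNReal.ofReal_ne_top, lintegral_sub_right_eq_self k y,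
      lintegral_indicator (measurableSet_annulus _ _), lintegral_const_mul _ hΩN]
    calc _ ≤ ENNReal.ofReal E * (ENNReal.ofReal κ *
          (ENNReal.ofReal (annulusConst (n + 1) * ρ ^ (n + 1)) * ENNReal.ofReal I)) := by
          rw [hI, ofReal_integral_abs_sphere hΩ hΩi]
          gcongr
          exact lintegral_annulus_normalize_le n hρ0 hΩ.enorm
      _ = _ := by
          rw [← ENNReal.ofReal_mul (by positivity), ← ENNReal.ofReal_mul hκ,
            ← ENNReal.ofReal_mul hE]
          congr 1
          have e : (4 : ℝ) ^ (n + 1) = 2 ^ (n + 1) * 2 ^ (n + 1) := by rw [← mul_pow]; norm_num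
          simp only [E, κ]
          rw [e]; field_simp
  have hmeas : AEMeasurable fun x => ENNReal.ofReal E * k (x - y) :=
    ((hk.comp (measurable_sub_const y)).const_mul _).aemeasurable
  calc _ ≤ _ := lintegral_mono_ae hpt
    _ = _ := lintegral_add_right' _ hmeas
    _ ≤ _ := add_le_add hfirst hsecond
    _ ≤ _ := by
      rw [← ENNReal.ofReal_add (by positivity) (by positivity)]
      refine ENNReal.ofReal_le_ofReal ?_
      have h1 : 0 ≤ 4 * 4 ^ (n + 1) * annulusConst (n + 1) * M * (2:ℝ) ^ (-(i:ℤ)) := by positivity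
      have h2 : 0 ≤ 16 ^ (n + 1) * M * ((i + s) * I) := by positivity
      linarith

/-- Tonelli's theorem for a weighted convolution. -/
lemma lintegral_mul_convK_le {d : ℕ} {w K h : Rd d → ℝ} {S : Set (Rd d)} {B : ℝ≥0∞}
    (hw : AEStronglyMeasurable w volume) (hK : Measurable K)
    (hh : AEStronglyMeasurable h volume) (hS : Function.support h ⊆ S)
    (hB : ∀ y ∈ S, ∫⁻ x, ‖w x‖ₑ * ‖K (x - y)‖ₑ ≤ B) :
    ∫⁻ x, ‖w x‖ₑ * ‖convK K h x‖ₑ ≤ B * ∫⁻ y, ‖h y‖ₑ := by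
  have hKm : Measurable fun p : Rd d × Rd d => ‖K (p.1 - p.2)‖ₑ :=
    (hK.comp (measurable_fst.sub measurable_snd)).enorm
  calc ∫⁻ x, ‖w x‖ₑ * ‖convK K h x‖ₑ
      ≤ ∫⁻ x, ∫⁻ y, ‖w x‖ₑ * (‖K (x - y)‖ₑ * ‖h y‖ₑ) := by
        refine lintegral_mono fun x => ?_
        rw [lintegral_const_mul' _ _ enorm_ne_top]
        gcongr
        refine (enorm_integral_le_lintegral_enorm _).trans_eq ?_
        simp [enorm_mul]
    _ = ∫⁻ y, ∫⁻ x, ‖w x‖ₑ * (‖K (x - y)‖ₑ * ‖h y‖ₑ) := by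
        refine lintegral_lintegral_swap ?_
        exact hw.comp_fst.enorm.mul (hKm.aemeasurable.mul hh.comp_snd.enorm)
    _ ≤ ∫⁻ y, B * ‖h y‖ₑ := by
        refine lintegral_mono fun y => ?_
        simp_rw [← mul_assoc]
        rw [lintegral_mul_const' _ _ enorm_ne_top]
        by_cases hy : h y = 0
        · simp [hy]
        · gcongr
          exact hB y (hS hy)
    _ = B * ∫⁻ y, ‖h y‖ₑ := lintegral_const_mul'' _ hh.enorm

/-- inequality (3.6) / claim (3.5).
`‖(b - ⟨b⟩_Q)T_j^i h_Q‖_{L¹} ≤ C_d ‖b‖_{BMO}(2^{-i} + (i+s)‖Ω_i‖_{L¹(S^{d-1})})‖h_Q‖_{L¹}`. -/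
theorem statement5 (d : ℕ) (hd : 2 ≤ d) (φ : Rd d → ℝ) (hφ : PhiCutoff φ) :
    ∃ C : ℝ, 0 < C ∧
      ∀ (i : ℕ) (Ωi : Rd d → ℝ), Measurable Ωi → Homog0 Ωi →
        (∀ᵐ θ ∂(sphereMeasure d), |Ωi θ| ≤ 2 ^ i) →
      ∀ (j : ℤ) (s : ℕ), 100 ≤ s →
      ∀ (Q : Set (Rd d)), IsCubeSide Q ((2:ℝ) ^ (j - (s:ℤ))) →
      ∀ (hQ : Rd d → ℝ), Integrable hQ volume → Function.support hQ ⊆ Q →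
      ∀ (b : Rd d → ℝ) (M : ℝ), BMOBound b M → 0 ≤ M →
        (∫⁻ x, ENNReal.ofReal (|b x - cavg b Q| * |convK (Kj Ωi φ j) hQ x|)) ≤
          ENNReal.ofReal
            (C * M * ((2:ℝ) ^ (-(i:ℤ)) + ((i:ℝ) + (s:ℝ)) * ∫ θ, |Ωi θ| ∂(sphereMeasure d)) *
              ∫ x, |hQ x|) := by
  obtain ⟨n, rfl⟩ : ∃ n, d = n + 1 := ⟨d - 1, by omega⟩
  have hA := annulusConst_pos (n + 1)
  refine ⟨16 ^ (n + 1) + 4 * 4 ^ (n + 1) * annulusConst (n + 1), by positivity, ?_⟩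
  intro i Ωi hΩ _ hΩi j s hs Q hQc h hh hsupp b M hb hM
  obtain ⟨c, rfl⟩ := hQc
  have havg : cavg b {x | ∀ i, x i ∈ Icc (c i) (c i + (2:ℝ) ^ (j - (s:ℤ)))} =
      ⨍ z in halfOpenCube c ((2:ℝ) ^ (j - (s:ℤ))), b z :=
    setAverage_congr (closedCube_ae_eq c _)
  have key := lintegral_mul_convK_le
    (hb.1.aestronglyMeasurable.sub aestronglyMeasurable_const)
    (measurable_Kj hΩ hφ j) hh.aestronglyMeasurable hsupp
    fun y hy => lintegral_oscillation_mul_Kj_le hφ hΩ hΩi (by omega : 1 ≤ s) hb hM hy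
  rw [← ofReal_integral_norm_eq_lintegral_enorm hh,
    ← ENNReal.ofReal_mul' (integral_nonneg fun _ => norm_nonneg _)] at key
  simpa only [havg, Pi.sub_apply, Real.norm_eq_abs, ENNReal.ofReal_mul (abs_nonneg _),
    ← Real.enorm_eq_ofReal_abs] using key
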